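/- Let y1, y2, y3 be distinct propositional variables. Then the set of clauses F(y1) ∪ F(y2) ∪ F(y3) ∪ {{¬y1,¬y2,¬y3}} ∪ D(y1,y1,y2,y2,y3,y3) is unsatisfiable, where each occurrence of the gadgets F and D uses its own fresh auxiliary variables, disjoint from each other and from {y1,y2,y3}. (This set witnesses an unsatisfiable instance of Monotone 3-Sat-(5,1): every variable appears exactly five times unnegated and exactly once negated.) -/

import Mathlib

/-- The gadget D(x₁,…,x₆) with auxiliary variables a,…,i: its clauses are all
satisfied under the given truth values (a clause is satisfied if at least one
of its literals evaluates to true). -/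
def Dgad (x₁ x₂ x₃ x₄ x₅ x₆ a b c d e f g h i : Bool) : Prop :=
  (!a || !c || !e) = true ∧ (!b || !f || !h) = true ∧ (!d || !g || !i) = true ∧
  (a || b || d) = true ∧ (a || d || f) = true ∧ (a || f || i) = true ∧
  (a || h || i) = true ∧ (b || c || d) = true ∧ (b || c || g) = true ∧
  (b || e || g) = true ∧ (c || g || h) = true ∧ (c || h || i) = true ∧
  (e || f || g) = true ∧ (e || f || i) = true ∧
  (a || g || x₁) = true ∧ (b || i || x₂) = true ∧ (c || f || x₃) = true ∧
  (d || e || x₄) = true ∧ (d || h || x₅) = true ∧ (e || h || x₆) = true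

/-- The gadget F(y) = D(y,u₁,u₁,u₁,u₁,u₁) ∪ D(y,u₂,u₂,u₂,u₂,u₂) ∪
D(y,u₃,u₃,u₃,u₃,u₃) ∪ {{¬u₁,¬u₂,¬u₃}}, where the k-th copy of D uses its own
nine fresh auxiliary variables `w k 0, …, w k 8`. -/
def Fgad (y u₁ u₂ u₃ : Bool) (w : Fin 3 → Fin 9 → Bool) : Prop :=
  Dgad y u₁ u₁ u₁ u₁ u₁
    (w 0 0) (w 0 1) (w 0 2) (w 0 3) (w 0 4) (w 0 5) (w 0 6) (w 0 7) (w 0 8) ∧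
  Dgad y u₂ u₂ u₂ u₂ u₂
    (w 1 0) (w 1 1) (w 1 2) (w 1 3) (w 1 4) (w 1 5) (w 1 6) (w 1 7) (w 1 8) ∧
  Dgad y u₃ u₃ u₃ u₃ u₃
    (w 2 0) (w 2 1) (w 2 2) (w 2 3) (w 2 4) (w 2 5) (w 2 6) (w 2 7) (w 2 8) ∧
  (!u₁ || !u₂ || !u₃) = true

/-- The gadget `Dgad` is unsatisfiable when all six of its inputs are false. -/
theorem not_Dgad_false (a b c d e f g h i : Bool) :
    ¬ Dgad false false false false false false a b c d e f g h i := by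
  unfold Dgad
  revert a b c d e f g h i
  decide

/-- The gadget `Fgad` forces its input to be true. -/
theorem Fgad.eq_true {y u₁ u₂ u₃ : Bool} {w : Fin 3 → Fin 9 → Bool}
    (h : Fgad y u₁ u₂ u₃ w) : y = true := by
  obtain ⟨h₁, h₂, h₃, hu⟩ := h
  cases y
  · cases u₁
    · exact (not_Dgad_false _ _ _ _ _ _ _ _ _ h₁).elim
    cases u₂
    · exact (not_Dgad_false _ _ _ _ _ _ _ _ _ h₂).elim
    cases u₃
    · exact (not_Dgad_false _ _ _ _ _ _ _ _ _ h₃).elim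
    · simp at hu
  · rfl

theorem stmt_10 :
    ∀ (y₁ y₂ y₃ : Bool) (u : Fin 3 → Fin 3 → Bool)
      (w : Fin 3 → Fin 3 → Fin 9 → Bool) (v : Fin 9 → Bool),
      ¬(Fgad y₁ (u 0 0) (u 0 1) (u 0 2) (w 0) ∧
        Fgad y₂ (u 1 0) (u 1 1) (u 1 2) (w 1) ∧
        Fgad y₃ (u 2 0) (u 2 1) (u 2 2) (w 2) ∧
        (!y₁ || !y₂ || !y₃) = true ∧
        Dgad y₁ y₁ y₂ y₂ y₃ y₃
          (v 0) (v 1) (v 2) (v 3) (v 4) (v 5) (v 6) (v 7) (v 8)) := by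
  rintro y₁ y₂ y₃ u w v ⟨h₁, h₂, h₃, hy, -⟩
  simp [h₁.eq_true, h₂.eq_true, h₃.eq_true] at hy
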